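/- arXiv:1511.09063 — 9 statements merged into one kernel-verified Lean document; each statement's English description precedes it below -/
import Mathlib

section
/- Let g : [0,∞) → ℝ be twice continuously differentiable with g(u) = u²·g₁(u), where g₁ is continuous on [0,∞), g₁(0) = 0, and g₁(u) > 0 and g₁′(u) > 0 for all u > 0. Fix A > 0 and set V = 2·g₁(A) and β = √V. Then there exists a function ω : ℝ → ℝ, twice continuously differentiable, such that: ω is even; ω(0) = 1, ω′(0) = 0, ω″(0) < 0; 0 < ω(η) < 1 for all η ≠ 0; there exist constants C, c > 0 with ω(η) ≤ C·exp(−c·|η|) for all η; and ω satisfies the profile equation A·β²·ω″(η) + g′(A·ω(η)) − A·V·ω(η) = 0 for all η ∈ ℝ. -/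
open MeasureTheory Filter

/-- An injective function with continuous nonzero derivative on an open set of reals has a
differentiable inverse on the image. -/
theorem exists_hasDerivAt_inverse_of_injOn {f f' : ℝ → ℝ} {S : Set ℝ} (hS : IsOpen S)
    (hf : ∀ x ∈ S, HasDerivAt f (f' x) x) (hf' : ContinuousOn f' S)
    (hne : ∀ x ∈ S, f' x ≠ 0) (hinj : Set.InjOn f S) :
    ∃ k : ℝ → ℝ, (∀ x ∈ S, k (f x) = x) ∧ ∀ x ∈ S, HasDerivAt k (f' x)⁻¹ (f x) := by
  have hk : ∀ x ∈ S, Function.invFunOn f S (f x) = x :=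
    fun x hx => hinj.leftInvOn_invFunOn hx
  refine ⟨Function.invFunOn f S, hk, fun x hx => ?_⟩
  have hstrict : HasStrictDerivAt f (f' x) x :=
    hasStrictDerivAt_of_hasDerivAt_of_continuousAt
      (by filter_upwards [hS.mem_nhds hx] with y hy using hf y hy)
      (hf'.continuousAt (hS.mem_nhds hx))
  exact (hstrict.to_local_left_inverse (hne x hx)
    (by filter_upwards [hS.mem_nhds hx] with y hy using hk y hy)).hasDerivAt

/-- If `h` increases from `h 0 = 0` through `h 1 = 1`, then `1 - q ^ 2 = h (W q)` can be solved for
`W` on `(-1, 1)`. -/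
theorem exists_hasDerivAt_level_param {h h' : ℝ → ℝ}
    (hd : ∀ u > 0, HasDerivAt h (h' u) u) (hpos : ∀ u > 0, 0 < h' u)
    (hc' : ContinuousOn h' (Set.Ioi 0)) (hc : ContinuousOn h (Set.Ici 0))
    (h0 : h 0 = 0) (h1 : h 1 = 1) :
    ∃ W : ℝ → ℝ, (∀ q, W (-q) = W q) ∧
      (∀ q ∈ Set.Ioo (-1 : ℝ) 1, 0 < W q ∧ h (W q) = 1 - q ^ 2 ∧
        HasDerivAt W (-2 * q / h' (W q)) q) ∧
      ∀ u > 0, ∀ q, h u = 1 - q ^ 2 → W q = u := by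
  have hmono : StrictMonoOn h (Set.Ici 0) := by
    refine strictMonoOn_of_deriv_pos (convex_Ici 0) hc fun x hx => ?_
    rw [interior_Ici] at hx
    rw [(hd x hx).deriv]
    exact hpos x hx
  obtain ⟨k, hk, hkd⟩ := exists_hasDerivAt_inverse_of_injOn isOpen_Ioi hd hc'
    (fun x hx => (hpos x hx).ne') (hmono.injOn.mono Set.Ioi_subset_Ici_self)
  refine ⟨fun q => k (1 - q ^ 2), fun q => by simp, fun q hq => ?_, fun u hu q huq => ?_⟩
  · have hmem : 1 - q ^ 2 ∈ Set.Icc (h 0) (h 1) := by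
      rw [h0, h1]
      constructor <;> nlinarith [hq.1, hq.2]
    obtain ⟨u, hu, huq⟩ := intermediate_value_Icc zero_le_one
      (hc.mono Set.Icc_subset_Ici_self) hmem
    have hu0 : 0 < u := by
      refine lt_of_le_of_ne hu.1 fun h => ?_
      rw [← h, h0] at huq
      nlinarith [hq.1, hq.2]
    have hku : k (1 - q ^ 2) = u := huq ▸ hk u hu0
    simp only [hku]
    refine ⟨hu0, huq, ?_⟩
    have hder : HasDerivAt (fun q : ℝ => 1 - q ^ 2) (-2 * q) q := by
      simpa using (hasDerivAt_pow 2 q).const_sub 1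
    exact (HasDerivAt.comp q (huq ▸ hkd u hu0 : HasDerivAt k (h' u)⁻¹ (1 - q ^ 2)) hder).congr_deriv
      (by ring)
  · simpa only [huq] using hk u hu

/-- A positive even continuous `F` on `(-1, 1)` whose reciprocal has a divergent primitive
generates a global odd solution of `Q' = F Q`. -/
theorem exists_odd_solution_of_autonomous {F : ℝ → ℝ} (hF : ContinuousOn F (Set.Ioo (-1) 1))
    (hpos : ∀ q ∈ Set.Ioo (-1 : ℝ) 1, 0 < F q) (heven : ∀ q, F (-q) = F q)
    (hdiv : ∀ G : ℝ → ℝ, G 0 = 0 → (∀ q ∈ Set.Ioo (-1 : ℝ) 1, HasDerivAt G (F q)⁻¹ q) →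
      ∀ N, 0 ≤ N → ∃ q ∈ Set.Ico (0 : ℝ) 1, N ≤ G q) :
    ∃ Q : ℝ → ℝ, (∀ η, Q η ∈ Set.Ioo (-1 : ℝ) 1) ∧ (∀ η, HasDerivAt Q (F (Q η)) η) ∧
      ∀ η, Q (-η) = -Q η := by
  have hFi : ContinuousOn (fun q => (F q)⁻¹) (Set.Ioo (-1) 1) :=
    hF.inv₀ fun q hq => (hpos q hq).ne'
  set G : ℝ → ℝ := fun q => ∫ t in (0 : ℝ)..q, (F t)⁻¹ with hG
  have hG0 : G 0 = 0 := by simp [hG]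
  have hGodd : ∀ q, G (-q) = -G q := by
    intro q
    have h := intervalIntegral.integral_comp_neg (a := 0) (b := q) (fun t => (F t)⁻¹)
    simp only [heven, neg_zero] at h
    simp only [hG]
    rw [h, intervalIntegral.integral_symm]
  have hGd : ∀ q ∈ Set.Ioo (-1 : ℝ) 1, HasDerivAt G (F q)⁻¹ q := by
    intro q hq
    have hsub : Set.uIcc 0 q ⊆ Set.Ioo (-1 : ℝ) 1 :=
      Set.OrdConnected.uIcc_subset Set.ordConnected_Ioo (by norm_num) hq
    exact intervalIntegral.integral_hasDerivAt_right (hFi.mono hsub).intervalIntegrable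
      (hFi.stronglyMeasurableAtFilter isOpen_Ioo q hq)
      (hFi.continuousAt (isOpen_Ioo.mem_nhds hq))
  have hGc : ContinuousOn G (Set.Ioo (-1) 1) :=
    fun q hq => (hGd q hq).continuousAt.continuousWithinAt
  have hGmono : StrictMonoOn G (Set.Ioo (-1) 1) := by
    refine strictMonoOn_of_deriv_pos (convex_Ioo _ _) hGc fun x hx => ?_
    rw [interior_Ioo] at hx
    rw [(hGd x hx).deriv]
    exact inv_pos.2 (hpos x hx)
  obtain ⟨Q, hQ, hQd⟩ := exists_hasDerivAt_inverse_of_injOn isOpen_Ioo hGd hFi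
    (fun x hx => (inv_pos.2 (hpos x hx)).ne') hGmono.injOn
  have hsurj_nonneg : ∀ η, 0 ≤ η → ∃ q ∈ Set.Ioo (-1 : ℝ) 1, G q = η := by
    intro η hη
    obtain ⟨b, hb, hbη⟩ := hdiv G hG0 hGd η hη
    have hsub : Set.Icc 0 b ⊆ Set.Ioo (-1 : ℝ) 1 :=
      fun x hx => ⟨by linarith [hx.1], hx.2.trans_lt hb.2⟩
    obtain ⟨q, hq, hqη⟩ := intermediate_value_Icc hb.1 (hGc.mono hsub) ⟨hG0.trans_le hη, hbη⟩
    exact ⟨q, hsub hq, hqη⟩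
  have hsurj : ∀ η, ∃ q ∈ Set.Ioo (-1 : ℝ) 1, G q = η := by
    intro η
    rcases le_total 0 η with hη | hη
    · exact hsurj_nonneg η hη
    · obtain ⟨q, hq, hqη⟩ := hsurj_nonneg (-η) (by linarith)
      exact ⟨-q, ⟨by linarith [hq.2], by linarith [hq.1]⟩, by rw [hGodd, hqη, neg_neg]⟩
  refine ⟨Q, fun η => ?_, fun η => ?_, fun η => ?_⟩ <;> obtain ⟨q, hq, rfl⟩ := hsurj η
  · rwa [hQ q hq]
  · simpa [hQ q hq] using hQd q hq
  · rw [← hGodd, hQ q hq, hQ (-q) ⟨by linarith [hq.2], by linarith [hq.1]⟩]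

/-- Existence of a homoclinic profile for `ω'' = ω (1 - h ω) - ω² h' ω / 2`. -/
theorem exists_homoclinic_profile {h h' : ℝ → ℝ}
    (hd : ∀ u > 0, HasDerivAt h (h' u) u) (hpos : ∀ u > 0, 0 < h' u)
    (hc' : ContinuousOn h' (Set.Ioi 0)) (hc : ContinuousOn h (Set.Ici 0))
    (h0 : h 0 = 0) (h1 : h 1 = 1) :
    ∃ ω : ℝ → ℝ, ContDiff ℝ 2 ω ∧
      (∀ η, ω (-η) = ω η) ∧
      ω 0 = 1 ∧ deriv ω 0 = 0 ∧ deriv (deriv ω) 0 < 0 ∧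
      (∀ η, 0 < ω η) ∧ (∀ η : ℝ, η ≠ 0 → ω η < 1) ∧
      (∃ C > (0:ℝ), ∃ c > (0:ℝ), ∀ η, ω η ≤ C * Real.exp (-c * |η|)) ∧
      (∀ η, deriv (deriv ω) η = ω η * (1 - h (ω η)) - ω η ^ 2 * h' (ω η) / 2) := by
  have hmono : StrictMonoOn h (Set.Ici 0) := by
    refine strictMonoOn_of_deriv_pos (convex_Ici 0) hc fun x hx => ?_
    rw [interior_Ici] at hx
    rw [(hd x hx).deriv]
    exact hpos x hx
  obtain ⟨W, hWeven, hW, hWu⟩ := exists_hasDerivAt_level_param hd hpos hc' hc h0 h1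
  have hWc : ContinuousOn W (Set.Ioo (-1) 1) :=
    fun q hq => (hW q hq).2.2.continuousAt.continuousWithinAt
  have hW0 : W 0 = 1 := hWu 1 one_pos 0 (by simp [h1])
  set F : ℝ → ℝ := fun q => W q * h' (W q) / 2 with hFdef
  have hFpos : ∀ q ∈ Set.Ioo (-1 : ℝ) 1, 0 < F q := fun q hq =>
    half_pos (mul_pos (hW q hq).1 (hpos _ (hW q hq).1))
  have hFc : ContinuousOn F (Set.Ioo (-1) 1) :=
    (hWc.mul (hc'.comp hWc fun q hq => (hW q hq).1)).div_const 2
  obtain ⟨Q, hQ, hQd, hQodd⟩ := exists_odd_solution_of_autonomous hFc hFpos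
    (fun q => by simp only [hFdef, hWeven]) (by
      intro G hG0 hGd N hN
      have hsub : Set.Ico (0 : ℝ) 1 ⊆ Set.Ioo (-1) 1 :=
        fun x hx => ⟨by linarith [hx.1], hx.2⟩
      have hder : ∀ q ∈ Set.Ioo (-1 : ℝ) 1,
          HasDerivAt (fun q => G q + Real.log (W q)) ((1 - q) / F q) q := by
        intro q hq
        obtain ⟨hWp, -, hWd⟩ := hW q hq
        have h'p := (hpos _ hWp).ne'
        have hWne := hWp.ne'
        refine ((hGd q hq).add (hWd.log hWne)).congr_deriv ?_
        simp only [hFdef]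
        field_simp
        ring
      have hmonoG : MonotoneOn (fun q => G q + Real.log (W q)) (Set.Ico 0 1) := by
        refine monotoneOn_of_deriv_nonneg (convex_Ico _ _)
          (fun q hq => (hder q (hsub hq)).continuousAt.continuousWithinAt)
          (fun q hq => (hder q (hsub (interior_subset hq))).differentiableAt.differentiableWithinAt)
          fun q hq => ?_
        have hq' := interior_subset hq
        rw [(hder q (hsub hq')).deriv]
        exact div_nonneg (by linarith [hq'.2]) (hFpos q (hsub hq')).le
      have hu1 : Real.exp (-N) ≤ 1 := Real.exp_le_one_iff.2 (by linarith)
      have hhpos : 0 < h (Real.exp (-N)) := by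
        rw [← h0]
        exact hmono Set.self_mem_Ici (Real.exp_pos _).le (Real.exp_pos _)
      have hhle : h (Real.exp (-N)) ≤ 1 := by
        rw [← h1]
        exact hmono.monotoneOn (Real.exp_pos _).le (Set.mem_Ici.2 zero_le_one) hu1
      have hqmem : Real.sqrt (1 - h (Real.exp (-N))) ∈ Set.Ico (0 : ℝ) 1 :=
        ⟨Real.sqrt_nonneg _, by rw [Real.sqrt_lt' one_pos]; linarith⟩
      refine ⟨_, hqmem, ?_⟩
      have hWq := hWu (Real.exp (-N)) (Real.exp_pos _) (Real.sqrt (1 - h (Real.exp (-N))))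
        (by rw [Real.sq_sqrt (by linarith)]; ring)
      have := hmonoG (Set.left_mem_Ico.2 one_pos) hqmem hqmem.1
      simp only [hG0, hW0, hWq, Real.log_one, Real.log_exp] at this
      linarith)
  have hQ0 : Q 0 = 0 := by
    have := hQodd 0
    rw [neg_zero] at this
    linarith
  have hQmono : StrictMono Q := strictMono_of_deriv_pos fun η => by
    rw [(hQd η).deriv]
    exact hFpos _ (hQ η)
  have hωpos : ∀ η, 0 < W (Q η) := fun η => (hW _ (hQ η)).1
  have hωd : ∀ η, HasDerivAt (fun η => W (Q η)) (-(Q η * W (Q η))) η := by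
    intro η
    have h'p := (hpos _ (hωpos η)).ne'
    refine (HasDerivAt.comp η (hW _ (hQ η)).2.2 (hQd η)).congr_deriv ?_
    simp only [hFdef]
    field_simp
  have hωlt : ∀ η, η ≠ 0 → W (Q η) < 1 := by
    intro η hη
    have hne : Q η ≠ 0 := fun h => hη (hQmono.injective (h.trans hQ0.symm))
    refine (hmono.lt_iff_lt (hωpos η).le (Set.mem_Ici.2 zero_le_one)).1 ?_
    rw [h1, (hW _ (hQ η)).2.1]
    have := sq_pos_of_ne_zero hne
    linarith
  have hωeven : ∀ η, W (Q (-η)) = W (Q η) := fun η => by rw [hQodd, hWeven]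
  have hω0 : W (Q 0) = 1 := by rw [hQ0, hW0]
  have hderiv : deriv (fun η => W (Q η)) = fun η => -(Q η * W (Q η)) :=
    funext fun η => (hωd η).deriv
  have hderiv2 : ∀ η, HasDerivAt (fun η => -(Q η * W (Q η)))
      (-(F (Q η) * W (Q η) + Q η * -(Q η * W (Q η)))) η :=
    fun η => ((hQd η).mul (hωd η)).neg
  have hQc : Continuous Q := continuous_iff_continuousAt.2 fun η => (hQd η).continuousAt
  have hωc : Continuous fun η => W (Q η) :=
    continuous_iff_continuousAt.2 fun η => (hωd η).continuousAt
  have hFQc : Continuous fun η => F (Q η) := hFc.comp_continuous hQc hQ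
  refine ⟨fun η => W (Q η), ?_, hωeven, hω0, ?_, ?_, hωpos, hωlt, ?_, fun η => ?_⟩
  · have h1 : ContDiff ℝ 1 fun η => -(Q η * W (Q η)) := by
      rw [contDiff_one_iff_deriv]
      refine ⟨fun η => (hderiv2 η).differentiableAt, ?_⟩
      rw [funext fun η => (hderiv2 η).deriv]
      exact ((hFQc.mul hωc).add (hQc.mul (hQc.mul hωc).neg)).neg
    rw [show (2 : WithTop ℕ∞) = 1 + 1 by norm_num, contDiff_succ_iff_deriv, hderiv]
    exact ⟨fun η => (hωd η).differentiableAt, by simp, h1⟩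
  · rw [hderiv]
    simp [hQ0]
  · rw [hderiv, (hderiv2 0).deriv, hω0, hQ0]
    have := hFpos 0 (by norm_num)
    linarith
  · have hc0 : 0 < Q 1 := hQ0 ▸ hQmono one_pos
    have hder : ∀ η, HasDerivAt (fun η => W (Q η) * Real.exp (Q 1 * η))
        ((Q 1 - Q η) * (W (Q η) * Real.exp (Q 1 * η))) η := by
      intro η
      have he : HasDerivAt (fun η => Real.exp (Q 1 * η)) (Real.exp (Q 1 * η) * Q 1) η := by
        simpa using ((hasDerivAt_id η).const_mul (Q 1)).exp
      exact ((hωd η).mul he).congr_deriv (by ring)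
    have hanti : AntitoneOn (fun η => W (Q η) * Real.exp (Q 1 * η)) (Set.Ici 1) := by
      refine antitoneOn_of_deriv_nonpos (convex_Ici 1)
        (fun η _ => (hder η).continuousAt.continuousWithinAt)
        (fun η _ => (hder η).differentiableAt.differentiableWithinAt) fun η hη => ?_
      rw [(hder η).deriv]
      exact mul_nonpos_of_nonpos_of_nonneg
        (sub_nonpos.2 (hQmono.monotone (interior_subset hη)))
        (mul_pos (hωpos η) (Real.exp_pos _)).le
    have hle : ∀ η, W (Q η) ≤ 1 := fun η => by
      rcases eq_or_ne η 0 with rfl | hη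
      · exact hω0.le
      · exact (hωlt η hη).le
    have hbound : ∀ η, 0 ≤ η → W (Q η) * Real.exp (Q 1 * η) ≤ Real.exp (Q 1) := by
      intro η hη
      rcases le_total η 1 with h | h
      · calc W (Q η) * Real.exp (Q 1 * η) ≤ 1 * Real.exp (Q 1) := by
              refine mul_le_mul (hle η) (Real.exp_le_exp.2 ?_) (Real.exp_pos _).le zero_le_one
              nlinarith
          _ = _ := one_mul _
      · calc W (Q η) * Real.exp (Q 1 * η) ≤ W (Q 1) * Real.exp (Q 1 * 1) :=
              hanti Set.self_mem_Ici h h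
          _ ≤ 1 * Real.exp (Q 1 * 1) := by gcongr; exact hle 1
          _ = _ := by simp
    refine ⟨Real.exp (Q 1), Real.exp_pos _, Q 1, hc0, fun η => ?_⟩
    have habs : W (Q |η|) = W (Q η) := by
      rcases abs_choice η with h | h <;> rw [h]
      exact hωeven η
    have := hbound |η| (abs_nonneg η)
    rw [habs] at this
    rwa [neg_mul, Real.exp_neg, ← div_eq_mul_inv, le_div_iff₀ (Real.exp_pos _)]
  · rw [hderiv, (hderiv2 η).deriv, (hW _ (hQ η)).2.1]
    simp only [hFdef]
    ring

/-- Existence of a soliton-type solitary wave profile for the generalized KdV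
equation `u_t + (g'(u))_x + ε² u_xxx = 0` with `g(u) = u² g₁(u)`. -/
theorem soliton_profile_exists
    (g g₁ : ℝ → ℝ) (hg : ContDiff ℝ 2 g)
    (hfact : ∀ u ≥ (0:ℝ), g u = u ^ 2 * g₁ u)
    (hg₁cont : ContinuousOn g₁ (Set.Ici 0))
    (hg₁zero : g₁ 0 = 0)
    (hg₁pos : ∀ u > (0:ℝ), 0 < g₁ u)
    (hg₁deriv : ∀ u > (0:ℝ), 0 < deriv g₁ u)
    (A : ℝ) (hA : 0 < A)
    (V β : ℝ) (hV : V = 2 * g₁ A) (hβ : β = Real.sqrt V) :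
    ∃ ω : ℝ → ℝ, ContDiff ℝ 2 ω ∧
      (∀ η, ω (-η) = ω η) ∧
      ω 0 = 1 ∧ deriv ω 0 = 0 ∧ deriv (deriv ω) 0 < 0 ∧
      (∀ η : ℝ, η ≠ 0 → 0 < ω η ∧ ω η < 1) ∧
      (∃ C > (0:ℝ), ∃ c > (0:ℝ), ∀ η, ω η ≤ C * Real.exp (-c * |η|)) ∧
      (∀ η, A * β ^ 2 * deriv (deriv ω) η + deriv g (A * ω η) - A * V * ω η = 0) := by
  have hgA : 0 < g₁ A := hg₁pos A hA
  have hβ2 : β ^ 2 = V := by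
    rw [hβ, Real.sq_sqrt (by rw [hV]; linarith)]
  have hd₁ : ∀ u > 0, HasDerivAt g₁ (deriv g₁ u) u := fun u hu =>
    (differentiableAt_of_deriv_ne_zero (hg₁deriv u hu).ne').hasDerivAt
  have hgder : ∀ u > 0, deriv g u = 2 * u * g₁ u + u ^ 2 * deriv g₁ u := by
    intro u hu
    have hmul : HasDerivAt (fun u => u ^ 2 * g₁ u) (2 * u * g₁ u + u ^ 2 * deriv g₁ u) u := by
      exact ((hasDerivAt_pow 2 u).mul (hd₁ u hu)).congr_deriv (by simp)
    refine (hmul.congr_of_eventuallyEq ?_).deriv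
    filter_upwards [Ioi_mem_nhds hu] with y hy using hfact y (le_of_lt hy)
  have hc₁ : ContinuousOn (deriv g₁) (Set.Ioi 0) := by
    have hgc : Continuous (deriv g) := hg.continuous_deriv (by norm_num)
    have hform : ContinuousOn (fun u => (deriv g u - 2 * u * g₁ u) / u ^ 2) (Set.Ioi 0) := by
      refine ContinuousOn.div ?_ (by fun_prop) fun u hu => pow_ne_zero 2 (ne_of_gt hu)
      exact hgc.continuousOn.sub
        (ContinuousOn.mul (by fun_prop) (hg₁cont.mono Set.Ioi_subset_Ici_self))
    refine hform.congr fun u hu => ?_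
    have hu' : u ≠ 0 := ne_of_gt hu
    simp only [hgder u hu]
    field_simp
    ring
  obtain ⟨ω, hsm, heven, hω0, hω1, hω2, hωpos, hωlt, hexp, hode⟩ :=
    exists_homoclinic_profile (h := fun u => g₁ (A * u) / g₁ A)
      (h' := fun u => deriv g₁ (A * u) * A / g₁ A)
      (fun u hu => by
        have hlin : HasDerivAt (fun u => A * u) A u := by
          simpa using (hasDerivAt_id u).const_mul A
        exact (HasDerivAt.comp u (hd₁ _ (mul_pos hA hu)) hlin).div_const _)
      (fun u hu => div_pos (mul_pos (hg₁deriv _ (mul_pos hA hu)) hA) hgA)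
      (((hc₁.comp (by fun_prop) fun u hu => mul_pos hA hu).mul continuousOn_const).div_const _)
      ((hg₁cont.comp (by fun_prop) fun u hu => mul_nonneg hA.le hu).div_const _)
      (by simp [hg₁zero]) (by simp [hgA.ne'])
  refine ⟨ω, hsm, heven, hω0, hω1, hω2, fun η hη => ⟨hωpos η, hωlt η hη⟩, hexp, fun η => ?_⟩
  rw [hode, hgder _ (mul_pos hA (hωpos η)), hβ2, hV]
  have := hgA.ne'
  field_simp
  ring
end

section
/- Let g : [0,∞) → ℝ be twice continuously differentiable with g(u) = u²·g₁(u), where g₁ is continuous on [0,∞), g₁(0) = 0, and g₁(u) > 0 and g₁′(u) > 0 for u > 0, and fix A > 0. Suppose ω : [0,∞) → (0,1] is continuously differentiable with ω(0) = 1, ω(η) < 1 for η > 0, and ω′(η) = −ω(η)·√(1 − g₁(A·ω(η))/g₁(A)) for all η > 0. Then for every η ≥ 0 the improper integral ∫_{ω(η)}^{1} z⁻¹·(1 − g₁(A·z)/g₁(A))^{−1/2} dz converges and equals η. -/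
open MeasureTheory Filter intervalIntegral

/-- Implicit representation of the solitary-wave profile: if `ω` solves
`ω' = −ω·√(1 − g₁(Aω)/g₁(A))` on `(0,∞)` with `ω(0) = 1`, then
`η = ∫_{ω(η)}^{1} z⁻¹ (1 − g₁(Az)/g₁(A))^{−1/2} dz`. -/
theorem profile_implicit_representation
    (g g₁ : ℝ → ℝ) (hg : ContDiff ℝ 2 g)
    (hfact : ∀ u ≥ (0:ℝ), g u = u ^ 2 * g₁ u)
    (hg₁cont : ContinuousOn g₁ (Set.Ici 0))
    (hg₁zero : g₁ 0 = 0)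
    (hg₁pos : ∀ u > (0:ℝ), 0 < g₁ u)
    (hg₁deriv : ∀ u > (0:ℝ), 0 < deriv g₁ u)
    (A : ℝ) (hA : 0 < A)
    (ω : ℝ → ℝ) (hωC : ContDiffOn ℝ 1 ω (Set.Ici 0))
    (hω1 : ω 0 = 1) (hωpos : ∀ η ≥ (0:ℝ), 0 < ω η) (hωlt : ∀ η > (0:ℝ), ω η < 1)
    (hode : ∀ η > (0:ℝ),
      HasDerivAt ω (-(ω η) * Real.sqrt (1 - g₁ (A * ω η) / g₁ A)) η) :
    ∀ η ≥ (0:ℝ),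
      IntervalIntegrable
        (fun z => z⁻¹ * (Real.sqrt (1 - g₁ (A * z) / g₁ A))⁻¹) volume (ω η) 1 ∧
      ∫ z in (ω η)..1, z⁻¹ * (Real.sqrt (1 - g₁ (A * z) / g₁ A))⁻¹ = η := by
  have hmono : StrictMonoOn g₁ (Set.Ici 0) :=
    strictMonoOn_of_deriv_pos (convex_Ici 0) hg₁cont fun u hu => hg₁deriv u (by simpa using hu)
  have hsqrt : ∀ η > (0:ℝ), 0 < Real.sqrt (1 - g₁ (A * ω η) / g₁ A) := by
    intro η hη
    have hω := hωpos η hη.le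
    have hlt : g₁ (A * ω η) < g₁ A :=
      hmono (Set.mem_Ici.2 (by positivity)) (Set.mem_Ici.2 hA.le)
        (mul_lt_of_lt_one_right hA (hωlt η hη))
    exact Real.sqrt_pos.2 (sub_pos.2 ((div_lt_one (hg₁pos A hA)).2 hlt))
  have hanti : StrictAntiOn ω (Set.Ici 0) := by
    refine strictAntiOn_of_deriv_neg (convex_Ici 0) hωC.continuousOn fun η hη => ?_
    have hη' : 0 < η := by simpa using hη
    rw [(hode η hη').deriv, neg_mul]
    exact neg_neg_of_pos (mul_pos (hωpos η hη'.le) (hsqrt η hη'))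
  intro η hη
  have hle : ω η ≤ 1 := hω1 ▸ hanti.antitoneOn (Set.mem_Ici.2 le_rfl) (Set.mem_Ici.2 hη) hη
  have himage : ω '' Set.Ioo 0 η = Set.Ioo (ω η) 1 := by
    apply Set.Subset.antisymm
    · rintro _ ⟨t, ht, rfl⟩
      exact ⟨hanti (Set.mem_Ici.2 ht.1.le) (Set.mem_Ici.2 hη) ht.2, hωlt t ht.1⟩
    · rw [← hω1]
      exact intermediate_value_Ioo' hη (hωC.continuousOn.mono Set.Icc_subset_Ici_self)
  have hderiv : ∀ t ∈ Set.Ioo 0 η,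
      HasDerivWithinAt ω (-(ω t) * Real.sqrt (1 - g₁ (A * ω t) / g₁ A)) (Set.Ioo 0 η) t :=
    fun t ht => (hode t ht.1).hasDerivWithinAt
  have hinj : Set.InjOn ω (Set.Ioo 0 η) :=
    hanti.injOn.mono fun t ht => Set.mem_Ici.2 ht.1.le
  have hone : Set.EqOn (fun t => |-(ω t) * Real.sqrt (1 - g₁ (A * ω t) / g₁ A)| •
      ((ω t)⁻¹ * (Real.sqrt (1 - g₁ (A * ω t) / g₁ A))⁻¹)) (fun _ => (1:ℝ)) (Set.Ioo 0 η) := by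
    intro t ht
    have hs := hsqrt t ht.1
    have hω := hωpos t ht.1.le
    simp only [smul_eq_mul]
    rw [neg_mul, abs_neg, abs_of_pos (mul_pos hω hs), ← mul_inv,
      mul_inv_cancel₀ (mul_pos hω hs).ne']
  constructor
  · rw [intervalIntegrable_iff_integrableOn_Ioo_of_le hle, ← himage,
      integrableOn_image_iff_integrableOn_abs_deriv_smul measurableSet_Ioo hderiv hinj,
      integrableOn_congr_fun hone measurableSet_Ioo]
    exact integrableOn_const measure_Ioo_lt_top.ne
  · rw [integral_of_le hle, integral_Ioc_eq_integral_Ioo, ← himage,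
      integral_image_eq_integral_abs_deriv_smul measurableSet_Ioo hderiv hinj,
      setIntegral_congr_fun measurableSet_Ioo hone]
    simp [hη]
end

section
/- Let g : [0,∞) → ℝ with g(u) = u²·g₁(u), where g₁ is continuous on [0,∞), g₁(0) = 0, and g₁ is strictly increasing and positive on (0,∞), and fix A > 0. Suppose ω : [0,∞) → ℝ is continuously differentiable with ω(0) = 1, 0 < ω(η) < 1 for η > 0, ω(η) → 0 as η → ∞, and ω′(η) = −ω(η)·√(1 − g₁(A·ω(η))/g₁(A)) for η > 0. Then there exist constants C > 0 and c > 0 such that ω(η) ≤ C·exp(−c·η) for all η ≥ 0. -/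
open MeasureTheory Filter

/-- Grönwall-type decay: if `f' ≤ -c f` on `[T, ∞)`, then `f` decays at rate `c` there. -/
theorem le_mul_exp_neg_of_hasDerivAt_le {f f' : ℝ → ℝ} {c T : ℝ}
    (hf : ∀ x ≥ T, HasDerivAt f (f' x) x) (hle : ∀ x ≥ T, f' x ≤ -c * f x)
    {x : ℝ} (hx : T ≤ x) : f x ≤ f T * Real.exp (-c * (x - T)) := by
  have hd : ∀ y ≥ T, HasDerivAt (fun y => f y * Real.exp (c * y))
      (f' y * Real.exp (c * y) + f y * (Real.exp (c * y) * c)) y := fun y hy => by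
    have h := ((hasDerivAt_id y).const_mul c).exp
    simp only [id_eq, mul_one] at h
    exact (hf y hy).mul h
  have hanti : AntitoneOn (fun y => f y * Real.exp (c * y)) (Set.Ici T) := by
    refine antitoneOn_of_deriv_nonpos (convex_Ici T)
      (fun y hy => (hd y hy).continuousAt.continuousWithinAt) ?_ ?_
    · rw [interior_Ici]
      exact fun y hy => (hd y (le_of_lt hy)).differentiableAt.differentiableWithinAt
    · rw [interior_Ici]
      intro y hy
      rw [(hd y (le_of_lt hy)).deriv]
      nlinarith [hle y (le_of_lt hy), Real.exp_pos (c * y)]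
  have h : f x * Real.exp (c * x) ≤ f T * Real.exp (c * T) :=
    hanti Set.self_mem_Ici hx hx
  calc f x = f x * Real.exp (c * x) * Real.exp (-(c * x)) := by
        rw [mul_assoc, ← Real.exp_add, add_neg_cancel, Real.exp_zero, mul_one]
    _ ≤ f T * Real.exp (c * T) * Real.exp (-(c * x)) := by gcongr
    _ = f T * Real.exp (-c * (x - T)) := by
        rw [mul_assoc, ← Real.exp_add]
        ring_nf

/-- Exponential decay of the solitary-wave profile solving
`ω' = −ω·√(1 − g₁(Aω)/g₁(A))` on `(0,∞)`. -/
theorem profile_exponential_decay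
    (g g₁ : ℝ → ℝ) (hfact : ∀ u ≥ (0:ℝ), g u = u ^ 2 * g₁ u)
    (hg₁cont : ContinuousOn g₁ (Set.Ici 0))
    (hg₁zero : g₁ 0 = 0)
    (hg₁mono : StrictMonoOn g₁ (Set.Ioi 0))
    (hg₁pos : ∀ u > (0:ℝ), 0 < g₁ u)
    (A : ℝ) (hA : 0 < A)
    (ω : ℝ → ℝ) (hωC : ContDiffOn ℝ 1 ω (Set.Ici 0))
    (hω1 : ω 0 = 1) (hωbound : ∀ η > (0:ℝ), 0 < ω η ∧ ω η < 1)
    (hωlim : Tendsto ω atTop (nhds 0))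
    (hode : ∀ η > (0:ℝ),
      HasDerivAt ω (-(ω η) * Real.sqrt (1 - g₁ (A * ω η) / g₁ A)) η) :
    ∃ C > (0:ℝ), ∃ c > (0:ℝ), ∀ η ≥ (0:ℝ), ω η ≤ C * Real.exp (-c * η) := by
  have hωnn : ∀ᶠ η in atTop, A * ω η ∈ Set.Ici (0 : ℝ) := by
    filter_upwards [eventually_gt_atTop 0] with η hη
    exact (mul_pos hA (hωbound η hη).1).le
  have hAω : Tendsto (fun η => A * ω η) atTop (nhds 0) := by
    simpa using hωlim.const_mul A
  have hg₁lim : Tendsto (fun η => g₁ (A * ω η)) atTop (nhds 0) := by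
    have h := (hg₁cont 0 Set.self_mem_Ici).tendsto
    rw [hg₁zero] at h
    exact h.comp (tendsto_nhdsWithin_iff.2 ⟨hAω, hωnn⟩)
  have hgA : 0 < g₁ A := hg₁pos A hA
  have hsmall : ∀ᶠ η in atTop, g₁ (A * ω η) < 3 / 4 * g₁ A :=
    hg₁lim.eventually_lt_const (by positivity)
  obtain ⟨T, hT⟩ := eventually_atTop.1 (hsmall.and (eventually_gt_atTop 0))
  have hTpos : 0 < T := (hT T le_rfl).2
  have hsqrt : ∀ η ≥ T, 1 / 2 ≤ Real.sqrt (1 - g₁ (A * ω η) / g₁ A) := by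
    intro η hη
    have h : g₁ (A * ω η) / g₁ A < 3 / 4 := (div_lt_iff₀ hgA).2 (hT η hη).1
    apply Real.le_sqrt_of_sq_le
    linarith
  have hωle : ∀ η ≥ (0 : ℝ), ω η ≤ 1 := by
    intro η hη
    rcases hη.eq_or_lt with rfl | h
    · exact hω1.le
    · exact (hωbound η h).2.le
  refine ⟨Real.exp (1 / 2 * T), Real.exp_pos _, 1 / 2, by norm_num, fun η hη => ?_⟩
  have hexp : Real.exp (1 / 2 * T) * Real.exp (-(1 / 2) * η) =
      Real.exp (-(1 / 2) * (η - T)) := by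
    rw [← Real.exp_add]
    ring_nf
  rw [hexp]
  rcases le_total T η with h | h
  · calc ω η ≤ ω T * Real.exp (-(1 / 2) * (η - T)) :=
          le_mul_exp_neg_of_hasDerivAt_le (fun x hx => hode x (hT x hx).2)
            (fun x hx => by nlinarith [hsqrt x hx, (hωbound x (hT x hx).2).1]) h
      _ ≤ 1 * Real.exp (-(1 / 2) * (η - T)) := by
          gcongr
          exact hωle T hTpos.le
      _ = Real.exp (-(1 / 2) * (η - T)) := one_mul _
  · exact (hωle η hη).trans (Real.one_le_exp (by linarith))
end

section
/- Let κ > 1 be a real number and define ω : ℝ → ℝ by ω(η) = (cosh((κ−1)·η/2))^{−2/(κ−1)}. Then ω(0) = 1, 0 < ω(η) < 1 for η ≠ 0, ω is even, and ω satisfies ω′(η) = −ω(η)·√(1 − ω(η)^{κ−1}) for all η ≥ 0 and ω′(η) = +ω(η)·√(1 − ω(η)^{κ−1}) for all η ≤ 0. -/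
open MeasureTheory Filter

/-- Derivative of a power of `cosh` whose exponent `-(2 / a)` compensates the inner scaling. -/
theorem hasDerivAt_cosh_rpow_neg_two_div {a : ℝ} (ha : a ≠ 0) (x : ℝ) :
    HasDerivAt (fun y => Real.cosh (a * y / 2) ^ (-(2 / a)))
      (-(Real.cosh (a * x / 2) ^ (-(2 / a)) * Real.tanh (a * x / 2))) x := by
  have hc : 0 < Real.cosh (a * x / 2) := Real.cosh_pos _
  have hin : HasDerivAt (fun y : ℝ => a * y / 2) (a / 2) x := by
    simpa using ((hasDerivAt_id x).const_mul a).div_const 2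
  convert hin.cosh.rpow_const (p := -(2 / a)) (Or.inl hc.ne') using 1
  rw [Real.rpow_sub_one hc.ne', Real.tanh_eq_sinh_div_cosh]
  field_simp

/-- `1 - (cosh t ^ (-(2 / a))) ^ a` is the square of `tanh t`. -/
theorem sqrt_one_sub_cosh_rpow {a : ℝ} (ha : a ≠ 0) (t : ℝ) :
    √(1 - (Real.cosh t ^ (-(2 / a))) ^ a) = |Real.tanh t| := by
  have hc : 0 < Real.cosh t := Real.cosh_pos _
  have he : -(2 / a) * a = -(2 : ℕ) := by
    push_cast
    field_simp
  rw [← Real.sqrt_sq_eq_abs, ← Real.rpow_mul hc.le, he, Real.rpow_neg hc.le, Real.rpow_natCast,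
    Real.tanh_eq_sinh_div_cosh, div_pow, Real.sinh_sq]
  congr 1
  field_simp

/-- The explicit profile `ω(η) = (cosh((κ−1)η/2))^{−2/(κ−1)}` for the homogeneous
nonlinearity `g'(u) = u^κ`: it is even, equals `1` at `0`, lies in `(0,1)` away from
`0`, and solves `ω' = ∓ω·√(1 − ω^{κ−1})`. -/
theorem explicit_profile_homogeneous
    (κ : ℝ) (hκ : 1 < κ)
    (ω : ℝ → ℝ)
    (hω : ∀ η, ω η = Real.cosh ((κ - 1) * η / 2) ^ (-(2 / (κ - 1)))) :
    ω 0 = 1 ∧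
    (∀ η : ℝ, η ≠ 0 → 0 < ω η ∧ ω η < 1) ∧
    (∀ η, ω (-η) = ω η) ∧
    (∀ η ≥ (0:ℝ), deriv ω η = -(ω η) * Real.sqrt (1 - ω η ^ (κ - 1))) ∧
    (∀ η ≤ (0:ℝ), deriv ω η = ω η * Real.sqrt (1 - ω η ^ (κ - 1))) := by
  have ha : 0 < κ - 1 := sub_pos.2 hκ
  obtain rfl : ω = fun η => Real.cosh ((κ - 1) * η / 2) ^ (-(2 / (κ - 1))) := funext hω
  refine ⟨by simp, fun η hη => ⟨Real.rpow_pos_of_pos (Real.cosh_pos _) _, ?_⟩, fun η => ?_,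
    fun η hη => ?_, fun η hη => ?_⟩
  · refine Real.rpow_lt_one_of_one_lt_of_neg (Real.one_lt_cosh.2 ?_) (by simpa using ha)
    positivity
  · simp only [mul_neg, neg_div, Real.cosh_neg]
  · have ht : 0 ≤ Real.tanh ((κ - 1) * η / 2) := by
      rw [Real.tanh_eq_sinh_div_cosh]
      exact div_nonneg (Real.sinh_nonneg_iff.2 (by positivity)) (Real.cosh_pos _).le
    rw [(hasDerivAt_cosh_rpow_neg_two_div ha.ne' η).deriv, sqrt_one_sub_cosh_rpow ha.ne',
      abs_of_nonneg ht, neg_mul]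
  · have ht : Real.tanh ((κ - 1) * η / 2) ≤ 0 := by
      rw [Real.tanh_eq_sinh_div_cosh]
      refine div_nonpos_of_nonpos_of_nonneg (Real.sinh_nonpos_iff.2 ?_) (Real.cosh_pos _).le
      linarith [mul_nonpos_of_nonneg_of_nonpos ha.le hη]
    rw [(hasDerivAt_cosh_rpow_neg_two_div ha.ne' η).deriv, sqrt_one_sub_cosh_rpow ha.ne',
      abs_of_nonpos ht, mul_neg]
end

section
/- Let κ > 1 be a real number, A > 0, ε > 0, set V = 2·A^{κ−1}/(κ+1) and β = √V, and define ω(η) = (cosh((κ−1)·η/2))^{−2/(κ−1)}. Then the function u(t,x) = A·ω(β·(x − V·t)/ε) is positive, smooth in (t,x), and satisfies the equation ∂u/∂t + ∂(u^κ)/∂x + ε²·∂³u/∂x³ = 0 at every point (t,x) ∈ ℝ × ℝ. -/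
open MeasureTheory Filter

/-- The profile `ω(η) = cosh((κ-1)η/2)^{-2/(κ-1)}` of the soliton. -/
noncomputable def solitonProfile (κ η : ℝ) : ℝ :=
  Real.cosh ((κ - 1) * η / 2) ^ (-(2 / (κ - 1)))

/-- The derivative of the soliton profile. -/
noncomputable def solitonProfileDeriv (κ η : ℝ) : ℝ :=
  -(Real.cosh ((κ - 1) * η / 2) ^ (-(2 / (κ - 1)) - 1) * Real.sinh ((κ - 1) * η / 2))

lemma solitonProfile_pos (κ η : ℝ) : 0 < solitonProfile κ η :=
  Real.rpow_pos_of_pos (Real.cosh_pos _) _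

lemma contDiff_solitonProfile (κ : ℝ) {n : WithTop ℕ∞} : ContDiff ℝ n (solitonProfile κ) := by
  unfold solitonProfile
  refine ContDiff.rpow_const_of_ne ?_ fun η => (Real.cosh_pos _).ne'
  exact Real.contDiff_cosh.comp (by fun_prop)

lemma hasDerivAt_cosh_rpow (κ q η : ℝ) :
    HasDerivAt (fun η : ℝ => Real.cosh ((κ - 1) * η / 2) ^ q)
      (q * ((κ - 1) / 2) *
        (Real.cosh ((κ - 1) * η / 2) ^ (q - 1) * Real.sinh ((κ - 1) * η / 2))) η := by
  have h : HasDerivAt (fun η : ℝ => (κ - 1) * η / 2) ((κ - 1) / 2) η := by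
    simpa using ((hasDerivAt_id η).const_mul (κ - 1)).div_const 2
  refine (h.cosh.rpow_const (p := q) (Or.inl (Real.cosh_pos _).ne')).congr_deriv ?_
  ring

lemma hasDerivAt_solitonProfile {κ : ℝ} (hκ : κ ≠ 1) (η : ℝ) :
    HasDerivAt (solitonProfile κ) (solitonProfileDeriv κ η) η := by
  have hk : κ - 1 ≠ 0 := sub_ne_zero.2 hκ
  refine (hasDerivAt_cosh_rpow κ (-(2 / (κ - 1))) η).congr_deriv ?_
  rw [solitonProfileDeriv, show -(2 / (κ - 1)) * ((κ - 1) / 2) = -1 by field_simp]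
  ring

lemma solitonProfile_rpow {κ : ℝ} (hκ : κ ≠ 1) (η : ℝ) :
    solitonProfile κ η ^ κ = Real.cosh ((κ - 1) * η / 2) ^ (-(2 / (κ - 1)) - 2) := by
  have hk : κ - 1 ≠ 0 := sub_ne_zero.2 hκ
  rw [solitonProfile, ← Real.rpow_mul (Real.cosh_pos _).le]
  congr 1
  field_simp
  ring

/-- The profile equation `ω'' = ω - (κ+1)/2 · ω^κ`. -/
lemma hasDerivAt_solitonProfileDeriv {κ : ℝ} (hκ : κ ≠ 1) (η : ℝ) :
    HasDerivAt (solitonProfileDeriv κ)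
      (solitonProfile κ η - (κ + 1) / 2 * solitonProfile κ η ^ κ) η := by
  have hk : κ - 1 ≠ 0 := sub_ne_zero.2 hκ
  have h : HasDerivAt (fun η : ℝ => (κ - 1) * η / 2) ((κ - 1) / 2) η := by
    simpa using ((hasDerivAt_id η).const_mul (κ - 1)).div_const 2
  refine (((hasDerivAt_cosh_rpow κ (-(2 / (κ - 1)) - 1) η).mul h.sinh).neg).congr_deriv ?_
  rw [solitonProfile_rpow hκ, solitonProfile]
  set c := Real.cosh ((κ - 1) * η / 2)
  set s := Real.sinh ((κ - 1) * η / 2)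
  have hcpos : 0 < c := Real.cosh_pos _
  have hsq : s ^ 2 = c ^ 2 - 1 := Real.sinh_sq _
  set p := -(2 / (κ - 1)) with hp
  have hpk : p * (κ - 1) = -2 := by rw [hp]; field_simp
  have h1 : c ^ (p - 1) = c ^ (p - 2) * c := by
    rw [← Real.rpow_add_one hcpos.ne']; ring_nf
  have h0 : c ^ p = c ^ (p - 2) * c ^ 2 := by
    rw [← Real.rpow_add_natCast hcpos.ne']; push_cast; ring_nf
  rw [show p - 1 - 1 = p - 2 by ring, h1, h0]
  clear_value p
  linear_combination -(c ^ (p - 2) * (p - 1) * ((κ - 1) / 2)) * hsq +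
    c ^ (p - 2) * (1 - c ^ 2) / 2 * hpk

lemma HasDerivAt.const_mul_comp_travelling {F : ℝ → ℝ} {F' : ℝ} (K β c ε y : ℝ)
    (h : HasDerivAt F F' (β * (y - c) / ε)) :
    HasDerivAt (fun y => K * F (β * (y - c) / ε)) (K * (β / ε) * F') y := by
  have hi : HasDerivAt (fun y : ℝ => β * (y - c) / ε) (β / ε) y := by
    simpa using (((hasDerivAt_id y).sub_const c).const_mul β).div_const ε
  refine ((h.comp y hi).const_mul K).congr_deriv ?_
  ring

/-- The explicit soliton `u(t,x) = A·(cosh((κ−1)β(x−Vt)/(2ε)))^{−2/(κ−1)}` with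
`V = 2A^{κ−1}/(κ+1)`, `β = √V` is a positive smooth solution of
`u_t + (u^κ)_x + ε² u_xxx = 0`. -/
theorem explicit_soliton_solves_gKdV
    (κ : ℝ) (hκ : 1 < κ) (A ε : ℝ) (hA : 0 < A) (hε : 0 < ε)
    (V β : ℝ) (hV : V = 2 * A ^ (κ - 1) / (κ + 1)) (hβ : β = Real.sqrt V)
    (ω : ℝ → ℝ)
    (hω : ∀ η, ω η = Real.cosh ((κ - 1) * η / 2) ^ (-(2 / (κ - 1))))
    (u : ℝ → ℝ → ℝ) (hu : ∀ t x, u t x = A * ω (β * (x - V * t) / ε)) :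
    (∀ t x, 0 < u t x) ∧
    ContDiff ℝ (⊤ : ℕ∞) (fun p : ℝ × ℝ => u p.1 p.2) ∧
    (∀ t x : ℝ,
      deriv (fun s => u s x) t
        + deriv (fun y => u t y ^ κ) x
        + ε ^ 2 * deriv (deriv (deriv (fun y => u t y))) x = 0) := by
  have hκ1 : κ ≠ 1 := hκ.ne'
  obtain rfl : ω = solitonProfile κ := funext hω
  obtain rfl : u = fun t x => A * solitonProfile κ (β * (x - V * t) / ε) :=
    funext₂ hu
  refine ⟨fun t x => mul_pos hA (solitonProfile_pos _ _), ?_, fun t x => ?_⟩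
  · exact contDiff_const.mul ((contDiff_solitonProfile κ).comp (by fun_prop))
  have hVβ : β ^ 2 = V := by
    rw [hβ, Real.sq_sqrt]
    rw [hV]
    have := Real.rpow_pos_of_pos hA (κ - 1)
    positivity
  have hAV : A * V * ((κ + 1) / 2) = A ^ κ := by
    have : A ^ κ = A ^ (κ - 1) * A := by rw [← Real.rpow_add_one hA.ne']; ring_nf
    rw [hV, this]
    have : κ + 1 ≠ 0 := by linarith
    field_simp
  have hω' := hasDerivAt_solitonProfile hκ1
  obtain ⟨E, hE⟩ : ∃ E : ℝ → ℝ, ∀ η, HasDerivAt (fun η => solitonProfile κ η ^ κ) (E η) η :=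
    ⟨_, fun η => (hω' η).rpow_const (Or.inl (solitonProfile_pos κ η).ne')⟩
  have ht : HasDerivAt (fun s => A * solitonProfile κ (β * (x - V * s) / ε))
      (-(A * V * (β / ε)) * solitonProfileDeriv κ (β * (x - V * t) / ε)) t := by
    have hi : HasDerivAt (fun s : ℝ => β * (x - V * s) / ε) (-(V * (β / ε))) t := by
      refine (((((hasDerivAt_id t).const_mul V).const_sub x).const_mul β).div_const ε).congr_deriv ?_
      ring
    refine (((hω' _).comp t hi).const_mul A).congr_deriv ?_
    ring
  have hpow : (fun y => (A * solitonProfile κ (β * (y - V * t) / ε)) ^ κ) =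
      fun y => A ^ κ * solitonProfile κ (β * (y - V * t) / ε) ^ κ :=
    funext fun y => Real.mul_rpow hA.le (solitonProfile_pos _ _).le
  have hx1 : deriv (fun y => A * solitonProfile κ (β * (y - V * t) / ε)) = _ :=
    funext fun y => ((hω' _).const_mul_comp_travelling A β (V * t) ε y).deriv
  have hx2 : deriv (fun y => A * (β / ε) * solitonProfileDeriv κ (β * (y - V * t) / ε)) = _ :=
    funext fun y => ((hasDerivAt_solitonProfileDeriv hκ1 _).const_mul_comp_travelling
      (A * (β / ε)) β (V * t) ε y).deriv
  have hx3 := ((hω' (β * (x - V * t) / ε)).sub ((hE _).const_mul ((κ + 1) / 2))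
    |>.const_mul_comp_travelling (A * (β / ε) * (β / ε)) β (V * t) ε x).deriv
  have hflux := ((hE _).const_mul_comp_travelling (A ^ κ) β (V * t) ε x).deriv
  simp only [Pi.sub_apply] at hx3
  beta_reduce
  rw [ht.deriv, hpow, hflux, hx1, hx2, hx3, ← hAV]
  have hεβ : ε ^ 2 * (β / ε) ^ 2 = V := by rw [← hVβ]; field_simp
  set D := solitonProfileDeriv κ (β * (x - V * t) / ε)
  linear_combination A * (β / ε) * (D - (κ + 1) / 2 * E (β * (x - V * t) / ε)) * hεβ
end

section
/- Let g : [0,∞) → ℝ be continuously differentiable with g(0) = 0 and g′(0) = 0, let A > 0, V ∈ ℝ, β ≠ 0, and let ω : ℝ → ℝ be twice continuously differentiable with values in [0,∞), satisfying the profile equation A·β²·ω″(η) + g′(A·ω(η)) − A·V·ω(η) = 0 for all η. Assume ω(η) → 0 and ω′(η) → 0 as η → ±∞, and that the functions ω², (ω′)², g(A·ω), and ω·g′(A·ω) are integrable on ℝ. Then V·∫_ℝ ω² dη + (2/A²)·∫_ℝ [g(A·ω(η)) − A·ω(η)·g′(A·ω(η))] dη + 3·β²·∫_ℝ (ω′)²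 dη = 0. -/
open MeasureTheory Filter

/-- The first integral `β²(ω')² = Vω² − 2g(Aω)/A²` of the profile equation, cleared of
denominators, for a profile decaying at `+∞`. -/
theorem profile_first_integral {g ω : ℝ → ℝ} {A V β : ℝ}
    (hg : Differentiable ℝ g) (hg0 : g 0 = 0)
    (hω : Differentiable ℝ ω) (hω' : Differentiable ℝ (deriv ω))
    (hprof : ∀ η, A * β ^ 2 * deriv (deriv ω) η + deriv g (A * ω η) - A * V * ω η = 0)
    (hlim : Tendsto ω atTop (nhds 0)) (hlim' : Tendsto (deriv ω) atTop (nhds 0)) (η : ℝ) :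
    A ^ 2 * β ^ 2 * deriv ω η ^ 2 + 2 * g (A * ω η) - V * A ^ 2 * ω η ^ 2 = 0 := by
  set E : ℝ → ℝ := fun η =>
    A ^ 2 * β ^ 2 * deriv ω η ^ 2 + 2 * g (A * ω η) - V * A ^ 2 * ω η ^ 2
  have hderiv (x : ℝ) : HasDerivAt E 0 x := by
    have h := (hω x).hasDerivAt
    have hgω := (hg (A * ω x)).hasDerivAt.comp x (h.const_mul A)
    refine (((((hω' x).hasDerivAt.pow 2).const_mul (A ^ 2 * β ^ 2)).add
      (hgω.const_mul 2)).sub ((h.pow 2).const_mul (V * A ^ 2))).congr_deriv ?_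
    push_cast
    linear_combination (2 * A * deriv ω x) * hprof x
  have hconst (x : ℝ) : E x = E η :=
    is_const_of_deriv_eq_zero (fun x => (hderiv x).differentiableAt)
      (fun x => (hderiv x).deriv) x η
  have hgω : Tendsto (fun η => g (A * ω η)) atTop (nhds 0) := by
    have h := (hg.continuous.tendsto (A * 0)).comp (hlim.const_mul A)
    rwa [mul_zero, hg0] at h
  have hElim : Tendsto E atTop (nhds 0) := by
    simpa using (((hlim'.pow 2).const_mul (A ^ 2 * β ^ 2)).add
      (hgω.const_mul 2)).sub ((hlim.pow 2).const_mul (V * A ^ 2))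
  exact tendsto_nhds_unique (tendsto_const_nhds.congr fun x => (hconst x).symm) hElim

/-- Multiplying the traveling-wave profile equation by `ω` and integrating over `ℝ`
gives `V·∫ω² + (2/A²)∫[g(Aω) − Aω·g'(Aω)] + 3β²∫(ω')² = 0`
(i.e. `a₂V + 2a_{g₂}g₂(A)/A² = −3a₂'β²`). -/
theorem profile_integrated_second_law
    (g : ℝ → ℝ) (hg : ContDiff ℝ 1 g) (hg0 : g 0 = 0) (hg'0 : deriv g 0 = 0)
    (A : ℝ) (hA : 0 < A) (V β : ℝ) (hβ : β ≠ 0)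
    (ω : ℝ → ℝ) (hω : ContDiff ℝ 2 ω) (hωnn : ∀ η, 0 ≤ ω η)
    (hprof : ∀ η, A * β ^ 2 * deriv (deriv ω) η + deriv g (A * ω η) - A * V * ω η = 0)
    (hlimtop : Tendsto ω atTop (nhds 0))
    (hlimbot : Tendsto ω atBot (nhds 0))
    (hlim'top : Tendsto (deriv ω) atTop (nhds 0))
    (hlim'bot : Tendsto (deriv ω) atBot (nhds 0))
    (hint1 : Integrable (fun η => (ω η) ^ 2))
    (hint2 : Integrable (fun η => (deriv ω η) ^ 2))
    (hint3 : Integrable (fun η => g (A * ω η)))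
    (hint4 : Integrable (fun η => ω η * deriv g (A * ω η))) :
    V * (∫ η, (ω η) ^ 2)
      + (2 / A ^ 2) * (∫ η, (g (A * ω η) - A * ω η * deriv g (A * ω η)))
      + 3 * β ^ 2 * (∫ η, (deriv ω η) ^ 2) = 0 := by
  have hgd : Differentiable ℝ g := hg.differentiable one_ne_zero
  have hωd : Differentiable ℝ ω := hω.differentiable two_ne_zero
  have hω'd : Differentiable ℝ (deriv ω) := hω.differentiable_deriv_two
  have energy : A ^ 2 * β ^ 2 * (∫ η, deriv ω η ^ 2) + 2 * (∫ η, g (A * ω η))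
      - V * A ^ 2 * (∫ η, ω η ^ 2) = 0 := by
    rw [← integral_const_mul, ← integral_const_mul, ← integral_const_mul,
      ← integral_add (hint2.const_mul _) (hint3.const_mul _),
      ← integral_sub (f := fun η => A ^ 2 * β ^ 2 * deriv ω η ^ 2 + 2 * g (A * ω η))
        ((hint2.const_mul _).add (hint3.const_mul _)) (hint1.const_mul _)]
    simp [profile_first_integral hgd hg0 hωd hω'd hprof hlimtop hlim'top]
  have virial : A * β ^ 2 * (∫ η, deriv ω η ^ 2) + A * V * (∫ η, ω η ^ 2)
      - (∫ η, ω η * deriv g (A * ω η)) = 0 := by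
    rw [← integral_const_mul, ← integral_const_mul,
      ← integral_add (hint2.const_mul _) (hint1.const_mul _),
      ← integral_sub (f := fun η => A * β ^ 2 * deriv ω η ^ 2 + A * V * ω η ^ 2)
        ((hint2.const_mul _).add (hint1.const_mul _)) hint4]
    refine (integral_of_hasDerivAt_of_tendsto (f := fun η => A * β ^ 2 * (ω η * deriv ω η))
      (m := 0) (n := 0) ?_ (((hint2.const_mul _).add (hint1.const_mul _)).sub hint4)
      (by simpa using (hlimbot.mul hlim'bot).const_mul (A * β ^ 2))
      (by simpa using (hlimtop.mul hlim'top).const_mul (A * β ^ 2))).trans (sub_zero 0)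
    intro x
    refine (((hωd x).hasDerivAt.mul (hω'd x).hasDerivAt).const_mul (A * β ^ 2)).congr_deriv ?_
    simp only [Pi.sub_apply, Pi.add_apply]
    linear_combination ω x * hprof x
  have split : (∫ η, (g (A * ω η) - A * ω η * deriv g (A * ω η)))
      = (∫ η, g (A * ω η)) - A * ∫ η, ω η * deriv g (A * ω η) := by
    simp_rw [mul_assoc A]
    rw [integral_sub hint3 (hint4.const_mul A), integral_const_mul]
  rw [split]
  field_simp
  linear_combination energy + 2 * A * virial
end

section
/- Let g : ℝ → ℝ be twice continuously differentiable with g(0) = 0 and g′(0) = 0, ε ∈ ℝ, and let u : ℝ × ℝ → ℝ be a smooth solution of ∂u/∂t + ∂(g′(u))/∂x + ε²·∂³u/∂x³ = 0 such that for each t the function x ↦ u(t,x) is Schwartz-class and all partial derivatives of u of order ≤ 3 are bounded, together with their products with x, by a fixed integrable function of x locally uniformly in t. Then for every t: d/dt ∫_ℝ x·u(t,x)² dx + 2·∫_ℝ [g(u(t,x)) − u(t,x)·g′(u(t,x))] dx + 3·ε²·∫_ℝ (∂u/∂x(t,x))² dx = 0. -/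
open MeasureTheory Filter

/-- A `C¹` function vanishing at `0` is dominated linearly along a Schwartz function. -/
lemma SchwartzMap.exists_abs_comp_le {K : ℝ → ℝ} (hK : ContDiff ℝ 1 K) (hK0 : K 0 = 0)
    (f : SchwartzMap ℝ ℝ) : ∃ C, ∀ x, |K (f x)| ≤ C * |f x| := by
  set M := SchwartzMap.seminorm ℝ 0 0 f
  have hM : ∀ x, |f x| ≤ M := fun x => SchwartzMap.norm_le_seminorm ℝ f x
  have hM0 : 0 ≤ M := (abs_nonneg _).trans (hM 0)
  obtain ⟨C, hC⟩ := (isCompact_Icc (a := -M) (b := M)).exists_bound_of_continuousOn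
    (hK.continuous_deriv le_rfl).continuousOn
  refine ⟨C, fun x => ?_⟩
  have key := (convex_Icc (-M) M).norm_image_sub_le_of_norm_deriv_le (f := K) (x := 0) (y := f x)
    (fun y _ => hK.differentiable one_ne_zero y) hC ⟨by linarith, hM0⟩ (abs_le.mp (hM x))
  simpa [hK0] using key

/-- `x ↦ x * f x` as a Schwartz function. -/
lemma SchwartzMap.exists_id_mul (f : SchwartzMap ℝ ℝ) :
    ∃ F : SchwartzMap ℝ ℝ, ∀ x, F x = x * f x :=
  ⟨SchwartzMap.smulLeftCLM ℝ (fun x : ℝ => x) f, fun x => by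
    rw [SchwartzMap.smulLeftCLM_apply_apply (by fun_prop), smul_eq_mul]⟩

lemma SchwartzMap.hasDerivAt_derivCLM (f : SchwartzMap ℝ ℝ) (x : ℝ) :
    HasDerivAt f (SchwartzMap.derivCLM ℝ ℝ f x) x := by
  rw [SchwartzMap.derivCLM_apply]
  exact f.differentiableAt.hasDerivAt

lemma SchwartzMap.integrable_mul (f g : SchwartzMap ℝ ℝ) :
    Integrable (fun x => f x * g x) :=
  g.integrable.bdd_mul f.continuous.aestronglyMeasurable
    (Eventually.of_forall (SchwartzMap.norm_le_seminorm ℝ f))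

/-- A Schwartz function is bounded by the integral of any integrable majorant of its derivative. -/
lemma SchwartzMap.abs_le_integral_of_abs_deriv_le (f : SchwartzMap ℝ ℝ) {φ : ℝ → ℝ}
    (hφ : Integrable φ) (h : ∀ x, |deriv f x| ≤ φ x) (x : ℝ) : |f x| ≤ ∫ y, φ y := by
  have hint : Integrable (deriv f) := (SchwartzMap.derivCLM ℝ ℝ f).integrable.congr
    (Eventually.of_forall fun y => SchwartzMap.derivCLM_apply ℝ f y)
  have hx := integral_Iic_of_hasDerivAt_of_tendsto (a := x) f.continuous.continuousWithinAt
    (fun y _ => f.differentiableAt.hasDerivAt) hint.integrableOn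
    (f.tendsto_cocompact.mono_left atBot_le_cocompact)
  rw [sub_zero] at hx
  calc |f x| = ‖∫ y in Set.Iic x, deriv f y‖ := by rw [hx, Real.norm_eq_abs]
    _ ≤ ∫ y in Set.Iic x, φ y :=
      norm_integral_le_of_norm_le hφ.integrableOn (Eventually.of_forall h)
    _ ≤ ∫ y, φ y := setIntegral_le_integral hφ
      (Eventually.of_forall fun y => (abs_nonneg _).trans (h y))

/-- The first moment of `2 f w`, where `w` is the right-hand side of the generalized KdV equation
evaluated at the Schwartz profile `f`. -/
lemma integral_moment_gKdV {g : ℝ → ℝ} (hg : ContDiff ℝ 2 g) (hg0 : g 0 = 0) (ε : ℝ)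
    (f : SchwartzMap ℝ ℝ) {w : ℝ → ℝ}
    (hw : ∀ x, w x + deriv (fun y => deriv g (f y)) x + ε ^ 2 * deriv (deriv (deriv f)) x = 0)
    (hint : Integrable fun x => x * (2 * f x * w x)) :
    ∫ x, x * (2 * f x * w x) = -(2 * (∫ x, (g (f x) - f x * deriv g (f x)))
      + 3 * ε ^ 2 * ∫ x, (deriv f x) ^ 2) := by
  have hdg : ContDiff ℝ 1 (deriv g) := ((contDiff_succ_iff_deriv (n := 1)).1 hg).2.2
  set K : ℝ → ℝ := fun v => g v - v * deriv g v with hKdef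
  have hK : ContDiff ℝ 1 K := (hg.of_le one_le_two).sub (contDiff_id.mul hdg)
  obtain ⟨C, hC⟩ := f.exists_abs_comp_le hK (by simp [hKdef, hg0])
  obtain ⟨F, hF⟩ := f.exists_id_mul
  set f₁ := SchwartzMap.derivCLM ℝ ℝ f with hf₁
  set f₂ := SchwartzMap.derivCLM ℝ ℝ f₁ with hf₂
  set f₃ := SchwartzMap.derivCLM ℝ ℝ f₂ with hf₃
  obtain ⟨F₁, hF₁⟩ := f₁.exists_id_mul
  have e₁ : deriv f = f₁ := funext fun x => (SchwartzMap.derivCLM_apply ℝ f x).symm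
  have e₂ : deriv f₁ = f₂ := funext fun x => (SchwartzMap.derivCLM_apply ℝ f₁ x).symm
  have e₃ : deriv f₂ = f₃ := funext fun x => (SchwartzMap.derivCLM_apply ℝ f₂ x).symm
  simp only [e₁, e₂, e₃] at hw ⊢
  have hKint : Integrable fun x => K (f x) := (f.integrable.norm.const_mul C).mono'
    (hK.continuous.comp f.continuous).aestronglyMeasurable (Eventually.of_forall hC)
  have hsq : Integrable fun x => f₁ x ^ 2 := by
    simpa only [sq] using f₁.integrable_mul f₁
  set W : ℝ → ℝ := fun x => 2 * (x * K (f x))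
    + ε ^ 2 * ((x * f₁ x) * f₁ x - 2 * ((x * f x) * f₂ x) + 2 * (f x * f₁ x)) with hW
  have hWd : ∀ x, HasDerivAt W
      (x * (2 * f x * w x) + (2 * K (f x) + 3 * ε ^ 2 * f₁ x ^ 2)) x := by
    intro x
    have d₀ := f.hasDerivAt_derivCLM x
    have d₁ := f₁.hasDerivAt_derivCLM x
    have d₂ := f₂.hasDerivAt_derivCLM x
    have dx := hasDerivAt_id x
    have dG := ((hg.differentiable two_ne_zero (f x)).hasDerivAt).comp x d₀
    have dH := ((hdg.differentiable one_ne_zero (f x)).hasDerivAt).comp x d₀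
    have hwx := hw x
    have eH : deriv (fun y => deriv g (f y)) x = _ := dH.deriv
    rw [eH] at hwx
    have := ((dx.mul (dG.sub (d₀.mul dH))).const_mul 2).add
      (((((dx.mul d₁).mul d₁).sub (((dx.mul d₀).mul d₂).const_mul 2)).add
        ((d₀.mul d₁).const_mul 2)).const_mul (ε ^ 2))
    refine this.congr_deriv ?_
    simp only [← hf₁, ← hf₂, ← hf₃, id, Function.comp, Pi.mul_apply, Pi.sub_apply, hKdef] at hwx ⊢
    linear_combination (-2 * x * f x) * hwx
  have hWlim : Tendsto W (cocompact ℝ) (nhds 0) := by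
    have hxK : Tendsto (fun x => x * K (f x)) (cocompact ℝ) (nhds 0) := by
      refine squeeze_zero_norm (a := fun x => C * |F x|) (fun x => ?_) ?_
      · rw [hF, norm_mul, abs_mul, mul_left_comm]
        exact mul_le_mul_of_nonneg_left (hC x) (abs_nonneg x)
      · simpa using F.tendsto_cocompact.abs.const_mul C
    simp only [hW, ← hF, ← hF₁]
    have t₀ := f.tendsto_cocompact
    have t₁ := f₁.tendsto_cocompact
    simpa using (hxK.const_mul 2).add ((((F₁.tendsto_cocompact.mul t₁).sub
      ((F.tendsto_cocompact.mul f₂.tendsto_cocompact).const_mul 2)).add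
        ((t₀.mul t₁).const_mul 2)).const_mul (ε ^ 2))
  have hrest : Integrable fun x => 2 * K (f x) + 3 * ε ^ 2 * f₁ x ^ 2 :=
    (hKint.const_mul 2).add (hsq.const_mul _)
  have htotal := integral_of_hasDerivAt_of_tendsto hWd (hint.add hrest)
    (hWlim.mono_left atBot_le_cocompact) (hWlim.mono_left atTop_le_cocompact)
  rw [integral_add hint hrest, integral_add (hKint.const_mul 2) (hsq.const_mul _),
    integral_const_mul, integral_const_mul, sub_zero] at htotal
  linarith

/-- Second balance law for smooth decaying solutions of the generalized KdV equation:
`d/dt ∫ x·u² dx + 2∫[g(u) − u·g'(u)] dx + 3ε²∫ u_x² dx = 0`. -/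
theorem second_balance_law
    (g : ℝ → ℝ) (hg : ContDiff ℝ 2 g) (hg0 : g 0 = 0) (hg'0 : deriv g 0 = 0)
    (ε : ℝ) (u : ℝ → ℝ → ℝ)
    (hu : ContDiff ℝ (⊤ : ℕ∞) (fun p : ℝ × ℝ => u p.1 p.2))
    (hpde : ∀ t x, deriv (fun s => u s x) t
      + deriv (fun y => deriv g (u t y)) x
      + ε ^ 2 * deriv (deriv (deriv (fun y => u t y))) x = 0)
    (hschwartz : ∀ t, ∃ f : SchwartzMap ℝ ℝ, ∀ x, f x = u t x)
    (hdom : ∀ T > (0:ℝ), ∃ φ : ℝ → ℝ, Integrable φ ∧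
      ∀ t ∈ Set.Icc (-T) T, ∀ x : ℝ, ∀ n : ℕ, n ≤ 3 →
        ‖iteratedFDeriv ℝ n (fun p : ℝ × ℝ => u p.1 p.2) (t, x)‖ ≤ φ x ∧
        |x| * ‖iteratedFDeriv ℝ n (fun p : ℝ × ℝ => u p.1 p.2) (t, x)‖ ≤ φ x) :
    ∀ t : ℝ, HasDerivAt (fun s => ∫ x, x * (u s x) ^ 2)
      (-(2 * (∫ x, (g (u t x) - u t x * deriv g (u t x)))
          + 3 * ε ^ 2 * ∫ x, (deriv (fun y => u t y) x) ^ 2)) t := by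
  intro t
  set U : ℝ × ℝ → ℝ := fun p => u p.1 p.2 with hU
  have hUd : Differentiable ℝ U := hu.differentiable (by simp)
  have htime : ∀ s x, HasDerivAt (fun r => u r x) (fderiv ℝ U (s, x) (1, 0)) s := fun s x =>
    (hUd (s, x)).hasFDerivAt.comp_hasDerivAt (f := fun r => (r, x)) s
      ((hasDerivAt_id s).prodMk (hasDerivAt_const s x))
  have hspace : ∀ s x, HasDerivAt (u s) (fderiv ℝ U (s, x) (0, 1)) x := fun s x =>
    (hUd (s, x)).hasFDerivAt.comp_hasDerivAt (f := fun y => (s, y)) x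
      ((hasDerivAt_const x s).prodMk (hasDerivAt_id x))
  have hcont : ∀ s, Continuous (u s) := fun s =>
    continuous_iff_continuousAt.2 fun x => (hspace s x).continuousAt
  have hcont' : Continuous fun x => fderiv ℝ U (t, x) (1, 0) :=
    ((hu.continuous_fderiv (by simp)).comp (Continuous.prodMk_right t)).clm_apply
      continuous_const
  obtain ⟨φ, hφ, hbound⟩ := hdom (|t| + 1) (by positivity)
  have hI : ∀ s ∈ Metric.ball t 1, s ∈ Set.Icc (-(|t| + 1)) (|t| + 1) := by
    intro s hs
    rw [Metric.mem_ball, Real.dist_eq] at hs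
    exact abs_le.1 (by linarith [abs_sub_abs_le_abs_sub s t])
  have hpartial : ∀ s x (v : ℝ × ℝ), ‖v‖ ≤ 1 →
      |fderiv ℝ U (s, x) v| ≤ ‖iteratedFDeriv ℝ 1 U (s, x)‖ := by
    intro s x v hv
    rw [norm_iteratedFDeriv_one]
    exact (fderiv ℝ U (s, x)).unit_le_opNorm v hv
  have hbdd : ∀ s ∈ Metric.ball t 1, ∀ x, |u s x| ≤ ∫ y, φ y := by
    intro s hs x
    obtain ⟨f, hf⟩ := hschwartz s
    rw [← hf x]
    refine f.abs_le_integral_of_abs_deriv_le hφ (fun y => ?_) x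
    rw [show (f : ℝ → ℝ) = u s from funext hf, (hspace s y).deriv]
    exact (hpartial s y (0, 1) (by simp)).trans (hbound s (hI s hs) y 1 (by norm_num)).1
  have ht : t ∈ Metric.ball t 1 := Metric.mem_ball_self one_pos
  obtain ⟨f, hf⟩ := hschwartz t
  obtain ⟨F, hF⟩ := f.exists_id_mul
  have hinit : Integrable fun x => x * u t x ^ 2 :=
    (F.integrable_mul f).congr (Eventually.of_forall fun x => by
      simp only [hF, hf]; ring)
  obtain ⟨hint, hderiv⟩ := hasDerivAt_integral_of_dominated_loc_of_deriv_le
    (μ := volume) (𝕜 := ℝ) (x₀ := t) (s := Metric.ball t 1)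
    (F := fun s x => x * u s x ^ 2)
    (F' := fun s x => x * (2 * u s x * fderiv ℝ U (s, x) (1, 0)))
    (bound := fun x => 2 * (∫ y, φ y) * φ x)
    (Metric.ball_mem_nhds t one_pos)
    (Eventually.of_forall fun s => (continuous_id.mul ((hcont s).pow 2)).aestronglyMeasurable)
    hinit
    (continuous_id.mul ((continuous_const.mul (hcont t)).mul hcont')).aestronglyMeasurable
    (Eventually.of_forall fun x s hs => by
      have h₁ := hbdd s hs x
      have h₂ : |x| * |fderiv ℝ U (s, x) (1, 0)| ≤ φ x :=
        (mul_le_mul_of_nonneg_left (hpartial s x (1, 0) (by simp)) (abs_nonneg x)).trans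
          (hbound s (hI s hs) x 1 (by norm_num)).2
      have h₃ := mul_le_mul h₁ h₂ (by positivity) ((abs_nonneg _).trans h₁)
      simp only [norm_mul, Real.norm_eq_abs, abs_two]
      linarith)
    (hφ.const_mul _)
    (Eventually.of_forall fun x s _ =>
      (((htime s x).pow 2).const_mul x).congr_deriv (by norm_num))
  have hft : (f : ℝ → ℝ) = u t := funext hf
  have hmoment := integral_moment_gKdV hg hg0 ε f (w := fun x => fderiv ℝ U (t, x) (1, 0))
    (fun x => by rw [hft, ← (htime t x).deriv]; exact hpde t x) (by rw [hft]; exact hint)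
  rw [hft] at hmoment
  rw [← hmoment]
  exact hderiv
end

section
/- Let ω : ℝ → ℝ be continuous, even, and satisfy |ω(η)| ≤ C₀·exp(−c₀·|η|) for some constants C₀, c₀ > 0. Let A ∈ ℝ, β > 0, φ ∈ ℝ, and let ψ : ℝ → ℝ be a smooth compactly supported test function. Then there exists a constant K > 0 (depending on ω, A, β, ψ but not on ε) such that for all ε ∈ (0,1]: | ∫_ℝ A·ω(β·(x − φ)/ε)·ψ(x) dx − ε·(A/β)·(∫_ℝ ω(η) dη)·ψ(φ) | ≤ K·ε³. -/
open MeasureTheory Filter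

/-- First-order Taylor estimate for a function whose derivative is Lipschitz. -/
theorem abs_sub_sub_mul_deriv_le_of_lipschitzWith {f : ℝ → ℝ} (hf : Differentiable ℝ f)
    {M : NNReal} (hM : LipschitzWith M (deriv f)) (x t : ℝ) :
    |f (x + t) - f x - t * deriv f x| ≤ M * t ^ 2 := by
  have hderiv : ∀ s ∈ Set.uIcc 0 t,
      HasDerivWithinAt (fun s => f (x + s) - s * deriv f x) (deriv f (x + s) - deriv f x)
        (Set.uIcc 0 t) s := fun s _ => by
    have h₁ : HasDerivAt (fun s => f (x + s)) (deriv f (x + s)) s :=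
      (hf (x + s)).hasDerivAt.comp_const_add x s
    have h₂ := h₁.sub ((hasDerivAt_id s).mul_const (deriv f x))
    rw [one_mul] at h₂
    exact h₂.hasDerivWithinAt
  have hbound : ∀ s ∈ Set.uIcc 0 t, ‖deriv f (x + s) - deriv f x‖ ≤ M * |t| := fun s hs => by
    have hst : |s| ≤ |t| := by simpa using Set.abs_sub_left_of_mem_uIcc hs
    have h := hM.dist_le_mul (x + s) x
    rw [Real.dist_eq, Real.dist_eq, add_sub_cancel_left] at h
    exact h.trans (by gcongr)
  have h := Convex.norm_image_sub_le_of_norm_hasDerivWithin_le hderiv hbound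
    (convex_uIcc 0 t) Set.left_mem_uIcc Set.right_mem_uIcc
  simp only [Real.norm_eq_abs, add_zero, zero_mul, sub_zero] at h
  rw [mul_assoc, abs_mul_abs_self] at h
  convert h using 1
  · congr 1; ring
  · ring

/-- A function of `|x|` is integrable as soon as it is integrable on the positive half-line. -/
theorem integrable_comp_abs_of_integrableOn_Ioi {f : ℝ → ℝ} (hf : IntegrableOn f (Set.Ioi 0)) :
    Integrable (fun x => f |x|) := by
  have hpos : IntegrableOn (fun x => f |x|) (Set.Ioi 0) :=
    hf.congr_fun (fun x hx => by rw [abs_of_pos hx]) measurableSet_Ioi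
  have hneg : IntegrableOn (fun x => f |x|) (Set.Iic 0) := by
    have hemb : MeasurableEmbedding (Neg.neg : ℝ → ℝ) := (Homeomorph.neg ℝ).measurableEmbedding
    rw [← Measure.map_neg_eq_self (volume : Measure ℝ), hemb.integrableOn_map_iff]
    simpa [Function.comp_def, integrableOn_Ici_iff_integrableOn_Ioi] using hpos
  rw [← integrableOn_univ, ← Set.Iic_union_Ioi (a := (0 : ℝ))]
  exact hneg.union hpos

/-- Polynomial moments of a continuous exponentially decaying function are integrable. -/
theorem integrable_pow_mul_of_abs_le_exp {ω : ℝ → ℝ} (hω : Continuous ω) {C c : ℝ} (hc : 0 < c)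
    (hdecay : ∀ η, |ω η| ≤ C * Real.exp (-c * |η|)) (n : ℕ) :
    Integrable (fun η => η ^ n * ω η) := by
  have h₁ : IntegrableOn (fun x : ℝ => x ^ n * Real.exp (-c * x)) (Set.Ioi 0) := by
    have h := integrableOn_rpow_mul_exp_neg_mul_rpow (s := (n : ℝ)) (p := 1) (b := c)
      (by have := n.cast_nonneg (α := ℝ); linarith) one_pos hc
    simpa using h
  have h₂ : Integrable (fun x : ℝ => |x| ^ n * Real.exp (-c * |x|)) :=
    integrable_comp_abs_of_integrableOn_Ioi h₁
  refine (h₂.const_mul C).mono' (by fun_prop) (Eventually.of_forall fun η => ?_)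
  rw [Real.norm_eq_abs, abs_mul, abs_pow, mul_left_comm]
  gcongr
  exact hdecay η

/-- The scaled pairing of an even profile with a test function agrees with its leading term up to
second order in the scale. -/
theorem abs_integral_even_mul_comp_sub_le {ω f : ℝ → ℝ} (heven : ∀ η, ω (-η) = ω η)
    (hint : ∀ n : ℕ, Integrable (fun η => η ^ n * ω η)) (hf : Differentiable ℝ f)
    (hbdd : ∃ B, ∀ x, ‖f x‖ ≤ B) {M : NNReal} (hM : LipschitzWith M (deriv f)) (x h : ℝ) :
    |(∫ η, ω η * f (x + h * η)) - (∫ η, ω η) * f x| ≤ M * (∫ η, η ^ 2 * |ω η|) * h ^ 2 := by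
  have hint₀ : Integrable ω := by simpa using hint 0
  have hint₁ : Integrable (fun η => η * ω η) := by simpa using hint 1
  have hint₂ : Integrable (fun η => η ^ 2 * |ω η|) := by simpa using (hint 2).abs
  have hodd : ∫ η, η * ω η = 0 := by
    have h := integral_neg_eq_self (fun η => η * ω η) volume
    simp only [heven, neg_mul, integral_neg] at h
    linarith
  obtain ⟨B, hB⟩ := hbdd
  have hprod : Integrable (fun η => ω η * f (x + h * η)) :=
    hint₀.mul_bdd (c := B) (hf.continuous.comp (by fun_prop)).aestronglyMeasurable
      (Eventually.of_forall fun η => hB _)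
  have hrem : (∫ η, ω η * f (x + h * η)) - (∫ η, ω η) * f x
      = ∫ η, (ω η * f (x + h * η) - ω η * f x - (η * ω η) * (h * deriv f x)) := by
    have hlead : Integrable (fun η => ω η * f x) := hint₀.mul_const _
    have hlin : Integrable (fun η => η * ω η * (h * deriv f x)) := hint₁.mul_const _
    have hdiff : Integrable (fun η => ω η * f (x + h * η) - ω η * f x) := hprod.sub hlead
    rw [integral_sub hdiff hlin, integral_sub hprod hlead, integral_mul_const, integral_mul_const, hodd]
    ring
  rw [hrem, ← Real.norm_eq_abs]
  refine (norm_integral_le_of_norm_le (hint₂.mul_const (M * h ^ 2))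
    (Eventually.of_forall fun η => ?_)).trans_eq ?_
  · have ht := abs_sub_sub_mul_deriv_le_of_lipschitzWith hf hM x (h * η)
    calc ‖ω η * f (x + h * η) - ω η * f x - η * ω η * (h * deriv f x)‖
        = |ω η| * |f (x + h * η) - f x - h * η * deriv f x| := by
          rw [Real.norm_eq_abs, ← abs_mul]; congr 1; ring
      _ ≤ |ω η| * (M * (h * η) ^ 2) := by gcongr
      _ = η ^ 2 * |ω η| * (M * h ^ 2) := by ring
  · rw [integral_mul_const]; ring

/-- Weak asymptotic expansion of a single solitary wave:
`∫ A·ω(β(x−φ)/ε)·ψ(x) dx = ε·(A/β)·(∫ω dη)·ψ(φ) + O(ε³)` for every test function `ψ`;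
the `ε²` term vanishes because `ω` is even. -/
theorem solitary_wave_weak_expansion
    (ω : ℝ → ℝ) (hωc : Continuous ω) (hωeven : ∀ η, ω (-η) = ω η)
    (C₀ c₀ : ℝ) (hC₀ : 0 < C₀) (hc₀ : 0 < c₀)
    (hdecay : ∀ η, |ω η| ≤ C₀ * Real.exp (-c₀ * |η|))
    (A : ℝ) (β : ℝ) (hβ : 0 < β) (φ : ℝ)
    (ψ : ℝ → ℝ) (hψ : ContDiff ℝ (⊤ : ℕ∞) ψ) (hψsupp : HasCompactSupport ψ) :
    ∃ K > (0:ℝ), ∀ ε ∈ Set.Ioc (0:ℝ) 1,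
      |(∫ x, A * ω (β * (x - φ) / ε) * ψ x)
          - ε * (A / β) * (∫ η, ω η) * ψ φ| ≤ K * ε ^ 3 := by
  have hψ₂ : ContDiff ℝ 2 ψ := contDiff_infty.1 hψ 2
  have hψ' : ContDiff ℝ 1 (deriv ψ) := (contDiff_succ_iff_deriv.1 hψ₂).2.2
  obtain ⟨M, hM⟩ := ContDiff.lipschitzWith_of_hasCompactSupport hψsupp.deriv hψ' one_ne_zero
  have hψbdd : ∃ B, ∀ x, ‖ψ x‖ ≤ B := hψsupp.exists_bound_of_continuous hψ.continuous
  have hint := integrable_pow_mul_of_abs_le_exp hωc hc₀ hdecay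
  set I := M * ∫ η, η ^ 2 * |ω η| with hI
  have hI₀ : 0 ≤ I := mul_nonneg M.coe_nonneg (integral_nonneg fun η => by positivity)
  refine ⟨|A| * I / β ^ 3 + 1, by positivity, fun ε ⟨hε, _⟩ => ?_⟩
  have hscale : ∫ x, A * ω (β * (x - φ) / ε) * ψ x
      = ε / β * (A * ∫ η, ω η * ψ (φ + ε / β * η)) := by
    have h := Measure.integral_comp_mul_left
      (fun η => A * (ω η * ψ (φ + ε / β * η))) (β / ε)
    rw [abs_of_pos (by positivity), inv_div, smul_eq_mul] at h
    rw [← integral_const_mul, ← h, ← integral_add_right_eq_self _ φ]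
    congr 1 with x
    rw [show φ + ε / β * (β / ε * x) = x + φ by field_simp; ring,
      show β * (x + φ - φ) / ε = β / ε * x by ring]
    ring
  have hmain := abs_integral_even_mul_comp_sub_le hωeven hint (hψ₂.differentiable two_ne_zero)
    hψbdd hM φ (ε / β)
  rw [← hI] at hmain
  calc |(∫ x, A * ω (β * (x - φ) / ε) * ψ x) - ε * (A / β) * (∫ η, ω η) * ψ φ|
      = |ε / β * A * ((∫ η, ω η * ψ (φ + ε / β * η)) - (∫ η, ω η) * ψ φ)| := by
        rw [hscale]; congr 1; ring
    _ = ε / β * |A| * |(∫ η, ω η * ψ (φ + ε / β * η)) - (∫ η, ω η) * ψ φ| := by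
        rw [abs_mul, abs_mul, abs_of_pos (div_pos hε hβ)]
    _ ≤ ε / β * |A| * (I * (ε / β) ^ 2) := by gcongr
    _ = |A| * I / β ^ 3 * ε ^ 3 := by ring
    _ ≤ (|A| * I / β ^ 3 + 1) * ε ^ 3 := by gcongr; linarith
end

section
/- Let μ′ > 0, A* > 0, A⁰ > 0, c = A⁰/A*, and let A(t) = A⁰·e^{μ′t}/(1 + c·(e^{μ′t} − 1)) for t ≥ 0. Let V* > 0 and let h : (0,∞) → ℝ be a locally Lipschitz function with h(A*) = V*. Define φ(t) = φ₀ + ∫₀ᵗ h(A(s)) ds for a constant φ₀ ∈ ℝ. Then there exists a finite limit L ∈ ℝ such that φ(t) − V*·t → L as t → ∞; that is, the trajectory x = φ(t) is asymptotic to a straight line. -/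
open MeasureTheory Filter intervalIntegral

/-- The logistic denominator dominates the exponential: a convex combination of `1` and `e ≥ 1`. -/
lemma min_one_mul_le_logistic_denom {c e : ℝ} (he : 1 ≤ e) :
    min 1 c * e ≤ 1 + c * (e - 1) := by
  rcases le_total c 1 with h | h
  · rw [min_eq_right h]; linarith
  · rw [min_eq_left h]; nlinarith

/-- A map that is locally Lipschitz on a neighbourhood of `a` satisfies
`f x - f a = O(x - a)` as `x → a`. -/
lemma LocallyLipschitzOn.isBigO_sub {f : ℝ → ℝ} {s : Set ℝ} {a : ℝ}
    (hf : LocallyLipschitzOn s f) (hs : s ∈ nhds a) :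
    (fun x => f x - f a) =O[nhds a] fun x => x - a := by
  obtain ⟨K, t, ht, hK⟩ := hf (mem_of_mem_nhds hs)
  rw [nhdsWithin_eq_nhds.2 hs] at ht
  refine Asymptotics.IsBigO.of_bound K ?_
  filter_upwards [ht] with x hx
  simpa [Real.dist_eq] using hK.dist_le_mul x hx a (mem_of_mem_nhds ht)

/-- If `f - v` is integrable at infinity, the primitive of `f` is asymptotically linear. -/
lemma tendsto_primitive_sub_linear {f : ℝ → ℝ} {v : ℝ}
    (hf : ContinuousOn f (Set.Ici 0)) (hi : IntegrableOn (fun s => f s - v) (Set.Ioi 0)) :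
    Tendsto (fun t => (∫ s in (0:ℝ)..t, f s) - v * t) atTop
      (nhds (∫ s in Set.Ioi (0:ℝ), (f s - v))) := by
  refine (intervalIntegral_tendsto_integral_Ioi 0 hi tendsto_id).congr' ?_
  filter_upwards [eventually_ge_atTop 0] with t ht
  have hint : IntervalIntegrable f volume 0 t :=
    (hf.mono (by rw [Set.uIcc_of_le ht]; exact Set.Icc_subset_Ici_self)).intervalIntegrable
  rw [id, integral_sub hint intervalIntegrable_const, intervalIntegral.integral_const]
  simp [mul_comm]

/-- The soliton trajectory `φ(t) = φ₀ + ∫₀ᵗ h(A(s)) ds`, driven by the logistic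
amplitude `A(t) → A*` and speed law `h` with `h(A*) = V*`, is asymptotic to a
straight line: `φ(t) − V*·t` has a finite limit as `t → ∞`. -/
theorem trajectory_asymptotically_linear
    (μ' Astar A0 : ℝ) (hμ : 0 < μ') (hAstar : 0 < Astar) (hA0 : 0 < A0)
    (c : ℝ) (hc : c = A0 / Astar)
    (A : ℝ → ℝ)
    (hA : ∀ t, A t = A0 * Real.exp (μ' * t) / (1 + c * (Real.exp (μ' * t) - 1)))
    (Vstar : ℝ) (hVstar : 0 < Vstar)
    (h : ℝ → ℝ) (hh : LocallyLipschitzOn (Set.Ioi 0) h) (hhA : h Astar = Vstar)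
    (φ₀ : ℝ) (φ : ℝ → ℝ)
    (hφ : ∀ t, φ t = φ₀ + ∫ s in (0:ℝ)..t, h (A s)) :
    ∃ L : ℝ, Tendsto (fun t => φ t - Vstar * t) atTop (nhds L) := by
  have hc0 : 0 < c := hc ▸ div_pos hA0 hAstar
  have hm : 0 < min 1 c := lt_min one_pos hc0
  have hcA : c * Astar = A0 := by rw [hc]; field_simp
  have hexp : ∀ t, 0 ≤ t → 1 ≤ Real.exp (μ' * t) := fun t ht =>
    Real.one_le_exp (by positivity)
  have hden : ∀ t, 0 ≤ t → 0 < 1 + c * (Real.exp (μ' * t) - 1) := fun t ht =>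
    (mul_pos hm (Real.exp_pos _)).trans_le (min_one_mul_le_logistic_denom (hexp t ht))
  have hApos : Set.MapsTo A (Set.Ici 0) (Set.Ioi 0) := fun t ht => by
    rw [Set.mem_Ioi, hA]
    exact div_pos (by positivity) (hden t ht)
  have hAcont : ContinuousOn A (Set.Ici 0) := by
    rw [funext hA]
    exact ContinuousOn.div (by fun_prop) (by fun_prop) fun t ht => (hden t ht).ne'
  have hAO : (fun t => A t - Astar) =O[atTop] fun t => Real.exp (-μ' * t) := by
    refine Asymptotics.IsBigO.of_bound (|A0 - Astar| / min 1 c) ?_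
    filter_upwards [eventually_ge_atTop 0] with t ht
    have hsub : A t - Astar = (A0 - Astar) / (1 + c * (Real.exp (μ' * t) - 1)) := by
      rw [hA, eq_div_iff (hden t ht).ne', sub_mul, div_mul_cancel₀ _ (hden t ht).ne']
      linear_combination (1 - Real.exp (μ' * t)) * hcA
    rw [hsub, Real.norm_eq_abs, Real.norm_eq_abs, abs_div, abs_of_pos (hden t ht),
      Real.abs_exp, neg_mul, Real.exp_neg, ← div_eq_mul_inv, div_div]
    exact div_le_div_of_nonneg_left (abs_nonneg _) (mul_pos hm (Real.exp_pos _))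
      (min_one_mul_le_logistic_denom (hexp t ht))
  have hAlim : Tendsto A atTop (nhds Astar) := by
    refine tendsto_sub_nhds_zero_iff.1 (hAO.trans_tendsto ?_)
    simpa using tendsto_id.const_mul_atTop hμ
  have hcont : ContinuousOn (fun t => h (A t)) (Set.Ici 0) :=
    hh.continuousOn.comp hAcont hApos
  have hO : (fun t => h (A t) - Vstar) =O[atTop] fun t => Real.exp (-μ' * t) :=
    hhA ▸ ((hh.isBigO_sub (Ioi_mem_nhds hAstar)).comp_tendsto hAlim).trans hAO
  have hi : IntegrableOn (fun t => h (A t) - Vstar) (Set.Ioi 0) :=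
    integrable_of_isBigO_exp_neg hμ (hcont.sub continuousOn_const) hO
  refine ⟨_, ((tendsto_primitive_sub_linear hcont hi).const_add φ₀).congr fun t => ?_⟩
  rw [hφ]
  ring
end
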